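/- arXiv:1709.05979 — 5 statements merged into one kernel-verified Lean document; each statement's English description precedes it below -/
import Mathlib

section
/- Let s ≥ 1, q₀ = 3^s, q = 3q₀², m = q − 3q₀ + 1, and let F be a finite field with q⁶ elements. Then the number of quadruples (x, y, z, t) ∈ F⁴ satisfying y^q − y = x^{q₀}(x^q − x), z^q − z = x^{2q₀}(x^q − x), and t^m = x^q − x equals q⁷ − q⁶ + q⁴. -/
namespace SkReeAux

section Hex
variable {K : Type*} [Field K]

def e0 : Fin 7 → K := ![1, 0, 0, 0, 0, 0, 0]

def st (a b : K) (p : Fin 7 → K) : Fin 7 → K :=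
  ![p 0, p 1 + a * p 0, p 2 + b * p 1, p 3 + a * (p 2 + b * p 1),
    p 4 + 2 * a * p 3 + a ^ 2 * (p 2 + b * p 1), p 5 + b * p 4,
    p 6 + a * (p 5 + b * p 4)]

def BB (p q : Fin 7 → K) : K :=
  p 0 * q 6 + p 6 * q 0 - p 1 * q 5 - p 5 * q 1 + p 2 * q 4 + p 4 * q 2 - 2 * (p 3 * q 3)

def crs (p q : Fin 7 → K) : Fin 7 → K :=
  ![2 * ((p 0 * q 3 - p 3 * q 0) - (p 1 * q 2 - p 2 * q 1)),
    -2 * ((p 1 * q 3 - p 3 * q 1) - (p 0 * q 4 - p 4 * q 0)),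
    2 * ((p 0 * q 5 - p 5 * q 0) - (p 2 * q 3 - p 3 * q 2)),
    (p 0 * q 6 - p 6 * q 0) + (p 1 * q 5 - p 5 * q 1) - (p 2 * q 4 - p 4 * q 2),
    2 * ((p 1 * q 6 - p 6 * q 1) - (p 3 * q 4 - p 4 * q 3)),
    -2 * ((p 3 * q 5 - p 5 * q 3) - (p 2 * q 6 - p 6 * q 2)),
    2 * ((p 3 * q 6 - p 6 * q 3) - (p 4 * q 5 - p 5 * q 4))]

def pt (a b : ℕ → K) : ℕ → ℕ → (Fin 7 → K)
  | _, 0 => e0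
  | i, (n + 1) => st (a i) (b i) (pt a b (i + 1) n)

theorem BB_st (a b : K) (p q : Fin 7 → K) : BB (st a b p) (st a b q) = BB p q := by
  simp [BB, st]; ring

theorem crs_st (a b : K) (p q : Fin 7 → K) : crs (st a b p) (st a b q) = st a b (crs p q) := by
  ext i; fin_cases i <;> simp [crs, st, -mul_eq_mul_left_iff] <;> ring

theorem st_smul (a b c : K) (p : Fin 7 → K) : st a b (c • p) = c • st a b p := by
  ext i; fin_cases i <;> simp [st] <;> ring

theorem st_zero (a b : K) : st a b (0 : Fin 7 → K) = 0 := by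
  ext i; fin_cases i <;> simp [st]

theorem BB_comm (p q : Fin 7 → K) : BB p q = BB q p := by simp [BB]; ring

theorem BB_smul (c : K) (p q : Fin 7 → K) : BB (c • p) q = c * BB p q := by simp [BB]; ring

theorem BB_sub (p p' q : Fin 7 → K) : BB (p - p') q = BB p q - BB p' q := by simp [BB]; ring

theorem BB_add (p p' q : Fin 7 → K) : BB (p + p') q = BB p q + BB p' q := by simp [BB]; ring

theorem BB_zero (q : Fin 7 → K) : BB 0 q = 0 := by simp [BB]

theorem crs_cyc (p q r : Fin 7 → K) : BB (crs p q) r = BB (crs q r) p := by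
  simp [BB, crs]; ring

theorem crs_swap (p q r : Fin 7 → K) : BB (crs p q) r = - BB (crs p r) q := by
  simp [BB, crs]; ring

theorem crs_self (p q : Fin 7 → K) : BB (crs p q) p = 0 := by
  simp [BB, crs]; ring

theorem crs_self2 (p q : Fin 7 → K) : BB (crs p q) q = 0 := by
  simp [BB, crs]; ring

theorem crs_anti (p q r : Fin 7 → K) : BB (crs p q) r = - BB (crs q p) r := by
  simp [BB, crs]; ring

theorem crs_norm (p q : Fin 7 → K) :
    BB (crs p q) (crs p q) = -2 * (BB p q ^ 2 - BB p p * BB q q) := by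
  simp [BB, crs]; ring

theorem crs_norm2 (x y z s : Fin 7 → K) :
    BB (crs x y) (crs z s) + BB (crs z y) (crs x s) =
      -2 * (BB x y * BB z s + BB z y * BB x s - 2 * (BB x z * BB y s)) +
      BB 0 0 := by
  simp [BB, crs]; ring

theorem e0_pt (p : Fin 7 → K) : BB e0 p = p 6 := by simp [BB, e0]

variable (a b : ℕ → K)

theorem BB_pt (i m n : ℕ) : BB (pt a b i m) (pt a b i (m + n)) = pt a b (i + m) n 6 := by
  induction m generalizing i with
  | zero => simp [pt, e0_pt]
  | succ m ih =>
    rw [show m + 1 + n = (m + n) + 1 by ring, pt, pt, BB_st, ih]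
    rw [show i + 1 + m = i + (m + 1) by ring]

theorem crs_pt1 (i m : ℕ) : crs (pt a b i m) (pt a b i (m + 1)) = 0 := by
  induction m generalizing i with
  | zero => 
    ext j; fin_cases j <;> simp [crs, pt, st, e0]
  | succ m ih =>
    rw [pt, pt, crs_st, ih, st_zero]

theorem crs_pt2 (i m : ℕ) : ∃ c : K, crs (pt a b i m) (pt a b i (m + 2)) = c • pt a b i (m + 1) := by
  induction m generalizing i with
  | zero => 
    refine ⟨2 * (a i * b i * a (i + 1)), ?_⟩
    ext j; fin_cases j <;> simp [crs, pt, st, e0, -mul_eq_mul_left_iff] <;> ring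
  | succ m ih =>
    obtain ⟨c, hc⟩ := ih (i + 1)
    refine ⟨c, ?_⟩
    rw [show m + 1 + 2 = (m + 2) + 1 by ring, pt, pt, crs_st, hc, st_smul, ← pt]

theorem pt_0 (i n : ℕ) : pt a b i n 0 = 1 := by
  induction n generalizing i with
  | zero => simp [pt, e0]
  | succ n ih => simp [pt, st, ih]

theorem D0 (i : ℕ) : pt a b i 0 6 = 0 := by simp [pt, e0]
theorem D1 (i : ℕ) : pt a b i 1 6 = 0 := by simp [pt, st, e0]
theorem D2 (i : ℕ) : pt a b i 2 6 = 0 := by simp [pt, st, e0]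
theorem D3 (i : ℕ) : pt a b i 3 6 = a i * b i * a (i+1) ^ 2 * b (i+1) * a (i+2) := by
  simp [pt, st, e0]; ring
theorem D4 (i : ℕ) : pt a b i 4 6 =
    a i * b i * a (i+1) ^ 2 * b (i+1) * (a (i+2) + a (i+3))
    + a i * b i * (a (i+1) + a (i+2)) ^ 2 * b (i+2) * a (i+3)
    + (a i + a (i+1)) * b (i+1) * a (i+2) ^ 2 * b (i+2) * a (i+3) := by
  simp [pt, st, e0, add_assoc]; ring

theorem D5 (i : ℕ) : pt a b i 5 6 =
    a i * b i * a (i+1) ^ 2 * b (i+1) * (a (i+2) + a (i+3) + a (i+4))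
    + a i * b i * (a (i+1) + a (i+2)) ^ 2 * b (i+2) * (a (i+3) + a (i+4))
    + a i * b i * (a (i+1) + a (i+2) + a (i+3)) ^ 2 * b (i+3) * a (i+4)
    + (a i + a (i+1)) * b (i+1) * a (i+2) ^ 2 * b (i+2) * (a (i+3) + a (i+4))
    + (a i + a (i+1)) * b (i+1) * (a (i+2) + a (i+3)) ^ 2 * b (i+3) * a (i+4)
    + (a i + a (i+1) + a (i+2)) * b (i+2) * a (i+3) ^ 2 * b (i+3) * a (i+4) := by
  simp [pt, st, e0, add_assoc]; ring

theorem Tsys (h3 : (3 : K) = 0) (i : ℕ) :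
    pt a b i 4 6 * pt a b (i+1) 4 6 - pt a b i 5 6 * pt a b (i+1) 3 6
    = a i * a (i+4) * (b i * a (i+1) ^ 3 * b (i+1) ^ 2 * a (i+2) ^ 3 * (b (i+2) + b (i+3))
      + b i * a (i+1) ^ 3 * (b (i+1) + b (i+2)) ^ 2 * a (i+3) ^ 3 * b (i+3)
      + (b i + b (i+1)) * a (i+2) ^ 3 * b (i+2) ^ 2 * a (i+3) ^ 3 * b (i+3)) := by
  rw [D4, D4, D5, D3]
  simp only [add_assoc, Nat.reduceAdd]
  generalize a i = a0
  generalize a (i+1) = a1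
  generalize a (i+2) = a2
  generalize a (i+3) = a3
  generalize a (i+4) = a4
  generalize b i = b0
  generalize b (i+1) = b1
  generalize b (i+2) = b2
  generalize b (i+3) = b3
  linear_combination ((1)*a0^1*a1^1*a2^2*a3^3*a4^1*b0^1*b2^2*b3^1 + (1)*a0^1*a1^2*a2^1*a3^3*a4^1*b0^1*b2^2*b3^1 + (1)*a0^1*a1^2*a2^1*a3^3*a4^1*b0^1*b1^1*b2^1*b3^1 + (1)*a0^1*a1^2*a2^2*a3^2*a4^1*b0^1*b1^1*b2^1*b3^1 + (1)*a0^1*a1^3*a2^1*a3^2*a4^1*b0^1*b1^1*b2^1*b3^1 + (1)*a0^1*a1^3*a2^1*a3^2*a4^1*b0^1*b1^2*b3^1 + (1)*a0^1*a1^3*a2^2*a3^1*a4^1*b0^1*b1^2*b3^1) * h3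

/-- A vector orthogonal to six points forming a hyperbolic frame, and isotropic, is zero. -/
theorem frame_zero (h2 : (2 : K) ≠ 0) (p : ℕ → (Fin 7 → K)) (d : ℕ → K) (hd : ∀ i, d i ≠ 0)
    (B0 : ∀ m, BB (p m) (p m) = 0) (B1 : ∀ m, BB (p m) (p (m+1)) = 0)
    (B2 : ∀ m, BB (p m) (p (m+2)) = 0) (B3 : ∀ m, BB (p m) (p (m+3)) = d m)
    (B4 : ∀ m, BB (p m) (p (m+4)) = 0) (B5 : ∀ m, BB (p m) (p (m+5)) = 0)
    (n : Fin 7 → K) (hn : ∀ i < 6, BB n (p i) = 0) (hnn : BB n n = 0) : n = 0 := by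
  have C1 : ∀ m, BB (p (m+1)) (p m) = 0 := fun m => by rw [BB_comm, B1]
  have C2 : ∀ m, BB (p (m+2)) (p m) = 0 := fun m => by rw [BB_comm, B2]
  have C3 : ∀ m, BB (p (m+3)) (p m) = d m := fun m => by rw [BB_comm, B3]
  have C4 : ∀ m, BB (p (m+4)) (p m) = 0 := fun m => by rw [BB_comm, B4]
  have C5 : ∀ m, BB (p (m+5)) (p m) = 0 := fun m => by rw [BB_comm, B5]
  have b01 : BB (p 0) (p 1) = 0 := B1 0
  have b10 : BB (p 1) (p 0) = 0 := C1 0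
  have b12 : BB (p 1) (p 2) = 0 := B1 1
  have b21 : BB (p 2) (p 1) = 0 := C1 1
  have b23 : BB (p 2) (p 3) = 0 := B1 2
  have b32 : BB (p 3) (p 2) = 0 := C1 2
  have b34 : BB (p 3) (p 4) = 0 := B1 3
  have b43 : BB (p 4) (p 3) = 0 := C1 3
  have b45 : BB (p 4) (p 5) = 0 := B1 4
  have b54 : BB (p 5) (p 4) = 0 := C1 4
  have b02 : BB (p 0) (p 2) = 0 := B2 0
  have b20 : BB (p 2) (p 0) = 0 := C2 0
  have b13 : BB (p 1) (p 3) = 0 := B2 1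
  have b31 : BB (p 3) (p 1) = 0 := C2 1
  have b24 : BB (p 2) (p 4) = 0 := B2 2
  have b42 : BB (p 4) (p 2) = 0 := C2 2
  have b35 : BB (p 3) (p 5) = 0 := B2 3
  have b53 : BB (p 5) (p 3) = 0 := C2 3
  have b03 : BB (p 0) (p 3) = d 0 := B3 0
  have b30 : BB (p 3) (p 0) = d 0 := C3 0
  have b14 : BB (p 1) (p 4) = d 1 := B3 1
  have b41 : BB (p 4) (p 1) = d 1 := C3 1
  have b25 : BB (p 2) (p 5) = d 2 := B3 2
  have b52 : BB (p 5) (p 2) = d 2 := C3 2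
  have b04 : BB (p 0) (p 4) = 0 := B4 0
  have b40 : BB (p 4) (p 0) = 0 := C4 0
  have b15 : BB (p 1) (p 5) = 0 := B4 1
  have b51 : BB (p 5) (p 1) = 0 := C4 1
  have b05 : BB (p 0) (p 5) = 0 := B5 0
  have b50 : BB (p 5) (p 0) = 0 := C5 0
  by_contra hne
  have key : LinearIndependent K (Fin.cons n (fun i : Fin 6 => p i) : Fin 7 → (Fin 7 → K)) := by
    rw [Fintype.linearIndependent_iff]
    intro g hg
    have hB : ∀ r : Fin 7 → K, g 0 * BB n r + (g 1 * BB (p 0) r + g 2 * BB (p 1) r +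
        g 3 * BB (p 2) r + g 4 * BB (p 3) r + g 5 * BB (p 4) r + g 6 * BB (p 5) r) = 0 := by
      intro r
      have := congrArg (fun v => BB v r) hg
      rw [Fin.sum_univ_succ] at this
      simp only [Fin.sum_univ_six, Fin.cons_zero, Fin.cons_succ, BB_add, BB_smul, BB_zero] at this
      simpa using this
    have c4 := hB (p 0)
    have c5 := hB (p 1)
    have c6 := hB (p 2)
    have c1 := hB (p 3)
    have c2 := hB (p 4)
    have c3 := hB (p 5)
    simp [hn, hd, B0, b01, b02, b03, b04, b05, b10, b12, b13, b14, b15, b20, b21, b23, b24, b25, b30, b31, b32, b34, b35, b40, b41, b42, b43, b45, b50, b51, b52, b53, b54] at c1 c2 c3 c4 c5 c6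
    have c0 : g 0 = 0 := by
      rw [Fin.sum_univ_succ] at hg
      simp only [Fin.sum_univ_six, Fin.cons_zero, Fin.cons_succ] at hg
      have e1 : g (Fin.succ 0) = 0 := c1
      have e2 : g (Fin.succ 1) = 0 := c2
      have e3 : g (Fin.succ 2) = 0 := c3
      have e4 : g (Fin.succ 3) = 0 := c4
      have e5 : g (Fin.succ 4) = 0 := c5
      have e6 : g (Fin.succ 5) = 0 := c6
      rw [e1, e2, e3, e4, e5, e6] at hg
      simpa [hne] using hg
    intro i
    fin_cases i <;> assumption
  have hspan : Submodule.span K (Set.range (Fin.cons n (fun i : Fin 6 => p i) : Fin 7 → (Fin 7 → K))) = ⊤ :=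
    key.span_eq_top_of_card_eq_finrank (by simp)
  have hall : ∀ r : Fin 7 → K, BB n r = 0 := by
    intro r
    have hr : r ∈ Submodule.span K (Set.range (Fin.cons n (fun i : Fin 6 => p i) : Fin 7 → (Fin 7 → K))) := by
      rw [hspan]; trivial
    induction hr using Submodule.span_induction with
    | mem x hx =>
      obtain ⟨i, rfl⟩ := hx
      refine Fin.cases ?_ ?_ i
      · simpa using hnn
      · intro j; simpa using hn j j.2
    | zero => rw [BB_comm, BB_zero]
    | add x y _ _ hx hy => rw [BB_comm, BB_add, BB_comm x, BB_comm y, hx, hy, add_zero]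
    | smul c x _ hx => rw [BB_comm, BB_smul, BB_comm x, hx, mul_zero]
  apply hne
  have q0 := hall ![1,0,0,0,0,0,0]
  have q1 := hall ![0,1,0,0,0,0,0]
  have q2 := hall ![0,0,1,0,0,0,0]
  have q3 := hall ![0,0,0,1,0,0,0]
  have q4 := hall ![0,0,0,0,1,0,0]
  have q5 := hall ![0,0,0,0,0,1,0]
  have q6 := hall ![0,0,0,0,0,0,1]
  simp [BB, h2] at q0 q1 q2 q3 q4 q5 q6
  ext i
  fin_cases i <;> simp <;> assumption

set_option maxHeartbeats 1000000 in
theorem loop_closes (h3 : (3 : K) = 0) (ha : ∀ i, a i ≠ 0) (hb : ∀ i, b i ≠ 0)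
    (h4 : ∀ i, pt a b i 4 6 = 0)
    (hE : ∀ i, b i * a (i+1) ^ 3 * b (i+1) ^ 2 * a (i+2) ^ 3 * (b (i+2) + b (i+3))
      + b i * a (i+1) ^ 3 * (b (i+1) + b (i+2)) ^ 2 * a (i+3) ^ 3 * b (i+3)
      + (b i + b (i+1)) * a (i+2) ^ 3 * b (i+2) ^ 2 * a (i+3) ^ 3 * b (i+3) = 0) :
    pt a b 0 6 = e0 := by
  have h2 : (2 : K) ≠ 0 := by
    intro h2
    have : (1 : K) = 0 := by linear_combination h3 - h2
    exact one_ne_zero this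
  have d3 : ∀ i, pt a b i 3 6 ≠ 0 := by
    intro i; rw [D3]
    have := ha i; have := ha (i+1); have := ha (i+2); have := hb i; have := hb (i+1)
    positivity
  have h5 : ∀ i, pt a b i 5 6 = 0 := by
    intro i
    have := Tsys a b h3 i
    rw [hE i, h4 i] at this
    have h : pt a b i 5 6 * pt a b (i+1) 3 6 = 0 := by linear_combination -this
    exact (mul_eq_zero.mp h).resolve_right (d3 _)
  obtain ⟨p, hp⟩ : ∃ p : ℕ → (Fin 7 → K), ∀ n, p n = pt a b 0 n := ⟨_, fun _ => rfl⟩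
  have Bp : ∀ m n, BB (p m) (p (m + n)) = pt a b m n 6 := by
    intro m n; simpa [hp] using BB_pt a b 0 m n
  have B0 : ∀ m, BB (p m) (p m) = 0 := fun m => by simpa [D0] using Bp m 0
  have B1 : ∀ m, BB (p m) (p (m+1)) = 0 := fun m => by rw [Bp, D1]
  have B2 : ∀ m, BB (p m) (p (m+2)) = 0 := fun m => by rw [Bp, D2]
  have B4 : ∀ m, BB (p m) (p (m+4)) = 0 := fun m => by rw [Bp, h4]
  have B5 : ∀ m, BB (p m) (p (m+5)) = 0 := fun m => by rw [Bp, h5]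
  obtain ⟨d, hd⟩ : ∃ d : ℕ → K, ∀ n, d n = pt a b n 3 6 := ⟨_, fun _ => rfl⟩
  have B3 : ∀ m, BB (p m) (p (m+3)) = d m := fun m => by rw [Bp, hd]
  replace d3 : ∀ m, d m ≠ 0 := fun m => by rw [hd]; exact d3 m
  have X1 : ∀ m, crs (p m) (p (m+1)) = 0 := fun m => by rw [hp, hp]; exact crs_pt1 a b 0 m
  have X2 : ∀ m, ∃ c : K, crs (p m) (p (m+2)) = c • p (m+1) := fun m => by rw [hp, hp, hp]; exact crs_pt2 a b 0 m
  have frame := frame_zero h2 p d d3 B0 B1 B2 B3 B4 B5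
  have n0 : crs (p 0) (p 5) = 0 := by
    apply frame
    · intro i hi
      interval_cases i
      · exact crs_self _ _
      · rw [crs_swap, X1 0, BB_zero, neg_zero]
      · obtain ⟨c, hc⟩ := X2 0
        rw [crs_swap, hc, BB_smul, B4 1]; simp
      · obtain ⟨c, hc⟩ := X2 3
        rw [crs_swap, crs_cyc, hc, BB_smul, BB_comm, B4 0]; simp
      · rw [crs_swap, crs_cyc, X1 4, BB_zero, neg_zero]
      · exact crs_self2 _ _
    · rw [crs_norm, B5 0, B0]; ring
  have D6 : BB (p 0) (p 6) = 0 := by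
    have := crs_norm2 (p 0) (p 5) (p 6) (p 2)
    obtain ⟨c, hc⟩ := X2 0
    have e : BB (crs (p 6) (p 5)) (crs (p 0) (p 2)) = 0 := by
      rw [crs_anti, X1 5, BB_zero, neg_zero]
    rw [e, n0, BB_zero, B5 0, BB_comm (p 6) (p 5), B1 5, BB_zero, BB_comm (p 5) (p 2), B3 2] at this
    have h : (2 * 2 : K) * (BB (p 0) (p 6) * d 2) = 0 := by linear_combination -this
    simpa [h2, d3] using h
  have hp6 : p 6 - (d 3 / d 0) • p 0 = 0 := by
    apply frame
    · intro i hi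
      interval_cases i <;> rw [BB_sub, BB_smul]
      · rw [BB_comm, D6, B0]; simp
      · rw [BB_comm, B5 1, B1 0]; simp
      · rw [BB_comm, B4 2, B2 0]; simp
      · rw [BB_comm, B3 3, B3 0]; field_simp [d3 0]; simp
      · rw [BB_comm, B2 4, B4 0]; simp
      · rw [BB_comm, B1 5, B5 0]; simp
    · rw [BB_sub, BB_smul, BB_comm _ (_ - _), BB_comm _ (_ - _), BB_sub, BB_sub, BB_smul, BB_smul,
        B0, B0, D6, BB_comm, D6]; simp
  have e1 := congrFun hp6 0
  have e2 : p 0 = e0 := hp 0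
  have z6 : p 6 0 = 1 := by rw [hp, pt_0]
  have z0 : p 0 0 = 1 := by rw [hp, pt_0]
  simp [z6, z0] at e1
  rw [← sub_eq_zero.mp e1, one_smul, e2] at hp6
  rw [← hp]
  exact sub_eq_zero.mp hp6

end Hex
end SkReeAux

namespace SkReeAux
section Mom
variable {K : Type*} [Field K]

def Th (A M1 M2 M3 M4 : K) : Fin 7 → K :=
  ![1, A, M1, M2 - A * M1, M3 - A * M2, -M4 - M1 * M2 - A * M1 ^ 2,
    A * (-M4 - M1 * M2 - A * M1 ^ 2) - M1 * (M3 - A * M2) + (M2 - A * M1) ^ 2]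

theorem st_Th (h3 : (3 : K) = 0) (w V A M1 M2 M3 M4 : K) :
    st w V (Th A M1 M2 M3 M4) = Th (A + w) (M1 + V * A) (M2 + 2 * w * M1 + V * (A ^ 2 + 2 * w * A))
      (M3 + V * A ^ 3) (M4 + 2 * V * M3 + V ^ 2 * A ^ 3) := by
  ext i
  fin_cases i <;> simp [st, Th]
  · ring
  · linear_combination h3 * ((1)*M2^1*w^1 + (1)*M1^1*w^2 + (1)*A^1*w^2*V^1 + (1)*A^2*w^1*V^1)
  · linear_combination h3 * ((1)*M3^1*V^1 + (1)*A^3*V^2 + (1)*M1^2*w^1 + (1)*A^2*M1^1*V^1 + (2)*A^1*M1^1*w^1*V^1 + (1)*A^2*w^1*V^2)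
  · linear_combination h3 * ((-1)*M1^1*M2^1*w^1 + (1)*A^1*M1^2*w^1 + (1)*M3^1*w^1*V^1 + (-1)*A^1*M2^1*w^1*V^1 + (1)*A^1*M3^1*V^1 + (1)*A^4*V^2 + (1)*A^3*M1^1*V^1 + (2)*A^2*M1^1*w^1*V^1 + (1)*A^3*w^1*V^2)

def NN (f g : ℕ → K) : ℕ → ℕ → K
  | _, 0 => 0
  | i, (n + 1) => f i * (g (i + 1) - g i) + NN f g (i + 1) n

theorem pt_Th (h3 : (3 : K) = 0) (x v : ℕ → K) (n i : ℕ) :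
    pt (fun i => x (i+1) - x i) (fun i => v (i+1) - v i) i n =
    Th (x (i + n) - x i) (NN v x i n - v i * (x (i + n) - x i))
      (NN v (fun j => x j ^ 2) i n - 2 * x i * NN v x i n - v i * (x (i + n) - x i) ^ 2)
      (NN v (fun j => x j ^ 3) i n - v i * (x (i + n) ^ 3 - x i ^ 3))
      (NN (fun j => v j ^ 2) (fun j => x j ^ 3) i n - 2 * v i * NN v (fun j => x j ^ 3) i n
        + v i ^ 2 * (x (i + n) ^ 3 - x i ^ 3)) := by
  induction n generalizing i with
  | zero => 
    ext j; fin_cases j <;> simp [pt, e0, Th, NN]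
  | succ n ih =>
    have hc : (x (i + (n + 1)) - x (i + 1)) ^ 3 = x (i + (n+1)) ^ 3 - x (i + 1) ^ 3 := by
      linear_combination h3 * (-x (i + (n+1)) ^ 2 * x (i+1) + x (i + (n+1)) * x (i+1) ^ 2)
    rw [pt, ih, st_Th h3, show i + 1 + n = i + (n + 1) by ring, hc]
    simp only [NN]
    congr 1 <;> ring

theorem pt6_of (h3 : (3 : K) = 0) (x v : ℕ → K) (hx : x 6 = x 0)
    (h1 : NN v x 0 6 = 0) (h2 : NN v (fun j => x j ^ 2) 0 6 = 0)
    (h3' : NN v (fun j => x j ^ 3) 0 6 = 0)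
    (h4 : NN (fun j => v j ^ 2) (fun j => x j ^ 3) 0 6 = 0) :
    pt (fun i => x (i+1) - x i) (fun i => v (i+1) - v i) 0 6 = e0 := by
  rw [pt_Th h3, h1, h2, h3', h4]
  simp only [zero_add, hx]
  ext j; fin_cases j <;> simp [e0, Th]

theorem of_pt6 (h3 : (3 : K) = 0) (x v : ℕ → K)
    (h : pt (fun i => x (i+1) - x i) (fun i => v (i+1) - v i) 0 6 = e0) :
    x 6 = x 0 ∧ NN v x 0 6 = 0 ∧ NN v (fun j => x j ^ 2) 0 6 = 0 := by
  rw [pt_Th h3] at h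
  have c1 := congrFun h 1
  have c2 := congrFun h 2
  have c3 := congrFun h 3
  simp [Th, e0] at c1 c2 c3
  have e1 : NN v x 0 6 = 0 := by linear_combination c2 + v 0 * c1
  refine ⟨by linear_combination c1, e1, ?_⟩
  rw [e1, c1] at c3
  linear_combination c3

theorem pt6_D4 (a b : ℕ → K) (h : pt a b 0 6 = e0) : pt a b 0 4 6 = 0 := by
  have h1 := BB_pt a b 0 4 2
  have h2 := BB_pt a b 0 0 4
  simp only [zero_add] at h1 h2
  rw [h, D2] at h1
  rw [← h2, BB_comm]
  exact h1

theorem pt6_D3 (a b : ℕ → K) (h : pt a b 0 6 = e0) : pt a b 3 3 6 = pt a b 0 3 6 := by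
  have h1 := BB_pt a b 0 3 3
  have h2 := BB_pt a b 0 0 3
  simp only [zero_add] at h1 h2
  rw [h] at h1
  rw [← h2, BB_comm, ← h1]
  rfl

end Mom

section Frob
variable {K : Type*} [Field K] [CharP K 3]

/-- Frobenius bookkeeping: `q₀ = 3^s`, `q = 3^(2s+1)`. -/
theorem frob_sub (k : ℕ) (x y : K) : (x - y) ^ (3 ^ k) = x ^ (3 ^ k) - y ^ (3 ^ k) :=
  sub_pow_char_pow x y k

set_option maxHeartbeats 1000000 in
theorem main_iff (s q₀ q : ℕ) (hq₀ : q₀ = 3 ^ s) (hq : q = 3 * q₀ ^ 2) (x : K)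
    (hw : x ^ q - x ≠ 0) :
    (pt (fun i => (x ^ q - x) ^ (q ^ i)) (fun i => (x ^ q - x) ^ (3 * q₀ * q ^ i)) 0 4 6 = 0 ↔
      (x ^ (q ^ 6) = x ∧ ∑ i ∈ Finset.range 6, (x ^ q₀ * (x ^ q - x)) ^ (q ^ i) = 0 ∧
        ∑ i ∈ Finset.range 6, (x ^ (2 * q₀) * (x ^ q - x)) ^ (q ^ i) = 0)) ∧
    (x ^ (q ^ 6) = x → ∑ i ∈ Finset.range 6, (x ^ q₀ * (x ^ q - x)) ^ (q ^ i) = 0 →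
        ∑ i ∈ Finset.range 6, (x ^ (2 * q₀) * (x ^ q - x)) ^ (q ^ i) = 0 →
      (x ^ q - x) ^ ((1 + 3 * q₀ + 2 * q + 3 * q₀ * q + q ^ 2) * q ^ 3) =
      (x ^ q - x) ^ (1 + 3 * q₀ + 2 * q + 3 * q₀ * q + q ^ 2)) := by
  have h3 : (3 : K) = 0 := by exact_mod_cast CharP.cast_eq_zero K 3
  have hqp : q = 3 ^ (2 * s + 1) := by rw [hq, hq₀]; ring
  have hqi : ∀ i, q ^ i = 3 ^ ((2 * s + 1) * i) := fun i => by rw [hqp, ← pow_mul]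
  have h3q : 3 * q₀ = 3 ^ (s + 1) := by rw [hq₀]; ring
  have hvi : ∀ i, 3 * q₀ * q ^ i = 3 ^ (s + 1 + (2 * s + 1) * i) := fun i => by
    rw [h3q, hqi, ← pow_add]
  obtain ⟨X, hX⟩ : ∃ X : ℕ → K, ∀ i, X i = x ^ (q ^ i) := ⟨_, fun _ => rfl⟩
  obtain ⟨V, hV⟩ : ∃ V : ℕ → K, ∀ i, V i = x ^ (3 * q₀ * q ^ i) := ⟨_, fun _ => rfl⟩
  obtain ⟨U, hU⟩ : ∃ U : ℕ → K, ∀ i, U i = x ^ (q₀ * q ^ i) := ⟨_, fun _ => rfl⟩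
  have haX : (fun i => (x ^ q - x) ^ (q ^ i)) = fun i => X (i+1) - X i := by
    funext i
    rw [hqi, frob_sub, ← hqi, hX, hX, ← pow_mul, pow_succ' q i]
  have hbV : (fun i => (x ^ q - x) ^ (3 * q₀ * q ^ i)) = fun i => V (i+1) - V i := by
    funext i
    rw [hvi, frob_sub, ← hvi, hV, hV, ← pow_mul]
    congr 2; ring
  have hU3 : ∀ i, U i ^ 3 = V i := fun i => by
    rw [hU, hV, ← pow_mul]; congr 1; ring
  have hT1 : ∑ i ∈ Finset.range 6, (x ^ q₀ * (x ^ q - x)) ^ (q ^ i) = NN U X 0 6 := by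
    have : ∀ i, (x ^ q₀ * (x ^ q - x)) ^ (q ^ i) = U i * (X (i+1) - X i) := fun i => by
      rw [mul_pow, hU, ← congrFun haX i, ← pow_mul]
    simp only [this, Finset.sum_range_succ, NN, Finset.sum_range_zero]; ring
  have hT2 : ∑ i ∈ Finset.range 6, (x ^ (2 * q₀) * (x ^ q - x)) ^ (q ^ i)
      = NN (fun i => U i ^ 2) X 0 6 := by
    have : ∀ i, (x ^ (2 * q₀) * (x ^ q - x)) ^ (q ^ i) = U i ^ 2 * (X (i+1) - X i) := fun i => by
      rw [mul_pow, hU, ← congrFun haX i, ← pow_mul, ← pow_mul]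
      congr 2; ring
    simp only [this, Finset.sum_range_succ, NN, Finset.sum_range_zero]; ring
  -- Frobenius maps
  have frU : ∀ i, iterateFrobenius K 3 (s+1) (U i) = X (i+1) := fun i => by
    rw [iterateFrobenius_def, hU, hX, ← pow_mul, ← h3q]; congr 1; rw [pow_succ, hq]; ring
  have frX : ∀ i, iterateFrobenius K 3 (s+1) (X i) = V i := fun i => by
    rw [iterateFrobenius_def, hX, hV, ← pow_mul, ← h3q]; congr 1; ring
  have frV : ∀ i, iterateFrobenius K 3 (s+1) (V i) = X (i+1) ^ 3 := fun i => by
    rw [iterateFrobenius_def, hX, hV, ← pow_mul, ← pow_mul, ← h3q]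
    congr 1; rw [pow_succ, hq]; ring
  have fqX : ∀ i j, iterateFrobenius K 3 ((2*s+1)*j) (X i) = X (j+i) := fun i j => by
    rw [iterateFrobenius_def, hX, hX, ← pow_mul, ← hqi]; congr 1; ring
  have fqV : ∀ i j, iterateFrobenius K 3 ((2*s+1)*j) (V i) = V (j+i) := fun i j => by
    rw [iterateFrobenius_def, hV, hV, ← pow_mul, ← hqi]; congr 1; ring
  have hX6 : x ^ (q ^ 6) = x ↔ X 6 = X 0 := by rw [hX, hX]; simp
  have hXV : X 6 = X 0 → V 6 = V 0 := fun h => by rw [← frX, ← frX, h]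
  have cube : ∀ y z : K, y ^ 3 - z ^ 3 = (y - z) ^ 3 := fun y z => by
    linear_combination h3 * (y ^ 2 * z - y * z ^ 2)
  have cube' : ∀ y z : K, (y + z) ^ 3 = y ^ 3 + z ^ 3 := fun y z => by
    linear_combination h3 * (y ^ 2 * z + y * z ^ 2)
  -- Abel summation
  have A1 : X 6 = X 0 → iterateFrobenius K 3 (s+1) (NN U X 0 6) = - NN V X 0 6 := by
    intro h
    have h' := hXV h
    simp only [NN, map_add, map_mul, map_sub, frU, frX, map_zero]
    norm_num
    rw [h, h']; ring
  have A2 : X 6 = X 0 → iterateFrobenius K 3 (s+1) (NN (fun i => U i ^ 2) X 0 6)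
      = - NN V (fun j => X j ^ 2) 0 6 := by
    intro h
    have h' := hXV h
    simp only [NN, map_add, map_mul, map_sub, map_pow, frU, frX, map_zero]
    norm_num
    rw [h, h']; ring
  have A3 : NN V (fun j => X j ^ 3) 0 6 = (NN U X 0 6) ^ 3 := by
    simp only [NN, cube, cube', mul_pow, ← hU3]; ring
  have A4 : NN (fun j => V j ^ 2) (fun j => X j ^ 3) 0 6 = (NN (fun i => U i ^ 2) X 0 6) ^ 3 := by
    simp only [NN, cube, cube', mul_pow, ← hU3]; ring
  have hfin : X 6 = X 0 → NN U X 0 6 = 0 → NN (fun i => U i ^ 2) X 0 6 = 0 →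
      pt (fun i => X (i+1) - X i) (fun i => V (i+1) - V i) 0 6 = e0 := by
    intro h e1 e2
    apply pt6_of h3 X V h
    · have := A1 h; rw [e1, map_zero] at this; linear_combination this
    · have := A2 h; rw [e2, map_zero] at this; linear_combination this
    · rw [A3, e1]; ring
    · rw [A4, e2]; ring
  constructor
  · rw [haX, hbV, hT1, hT2, hX6]
    constructor
    · intro h0
      have h4 : ∀ i, pt (fun i => X (i+1) - X i) (fun i => V (i+1) - V i) i 4 6 = 0 := by
        intro i
        have := congrArg (iterateFrobenius K 3 ((2*s+1)*i)) h0
        rw [D4] at this ⊢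
        simp only [map_add, map_mul, map_sub, map_pow, fqX, fqV, map_zero] at this
        simpa only [add_assoc, Nat.reduceAdd, zero_add, add_zero] using this
      have hE : ∀ i, _ := fun i => congrArg (iterateFrobenius K 3 (s+1)) (h4 i)
      have hcl := loop_closes (fun i => X (i+1) - X i) (fun i => V (i+1) - V i) h3
        (fun i => by rw [← congrFun haX i]; exact pow_ne_zero _ hw)
        (fun i => by rw [← congrFun hbV i]; exact pow_ne_zero _ hw) h4
        (by
          intro i
          have := hE i
          rw [D4] at this
          simp only [map_add, map_mul, map_sub, map_pow, frX, frV, map_zero, cube] at this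
          simpa only [add_assoc, Nat.reduceAdd] using this)
      obtain ⟨c1, c2, c3⟩ := of_pt6 h3 X V hcl
      refine ⟨c1, ?_, ?_⟩
      · have := A1 c1
        rw [c2, neg_zero] at this
        exact (map_eq_zero_iff _ (iterateFrobenius K 3 (s+1)).injective).mp this
      · have := A2 c1
        rw [c3, neg_zero] at this
        exact (map_eq_zero_iff _ (iterateFrobenius K 3 (s+1)).injective).mp this
    · rintro ⟨h, e1, e2⟩
      exact pt6_D4 _ _ (hfin h e1 e2)
  · rw [hT1, hT2, hX6]
    intro h e1 e2
    have := pt6_D3 _ _ (hfin h e1 e2)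
    rw [← haX, ← hbV, D3, D3] at this
    have key : ∀ w : K, w ^ (q ^ 3) * w ^ (3 * q₀ * q ^ 3) * (w ^ (q ^ (3+1))) ^ 2 *
        w ^ (3 * q₀ * q ^ (3+1)) * w ^ (q ^ (3+2)) =
        w ^ ((1 + 3 * q₀ + 2 * q + 3 * q₀ * q + q ^ 2) * q ^ 3) := fun w => by
      rw [← pow_mul, ← pow_add, ← pow_add, ← pow_add, ← pow_add]; congr 1; ring
    have key' : ∀ w : K, w ^ (q ^ 0) * w ^ (3 * q₀ * q ^ 0) * (w ^ (q ^ (0+1))) ^ 2 *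
        w ^ (3 * q₀ * q ^ (0+1)) * w ^ (q ^ (0+2)) =
        w ^ (1 + 3 * q₀ + 2 * q + 3 * q₀ * q + q ^ 2) := fun w => by
      rw [← pow_mul, ← pow_add, ← pow_add, ← pow_add, ← pow_add]; congr 1; ring
    rw [key, key'] at this
    exact this

end Frob
end SkReeAux

namespace SkReeAux
section Poly
open Polynomial

theorem poly_count (K : Type*) [Field K] [IsAlgClosed K] [CharP K 3] (q k α β₁ β₂ β₃ γ₁ γ₂ : ℕ)
    (hq : q = 3 ^ (k + 1)) (hα0 : 0 < α) (h10 : 0 < β₁) (h20 : 0 < β₂) (h30 : 0 < β₃)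
    (hγ0 : 0 < γ₁) (hα : 3 ∣ α) (h1 : 3 ∣ β₁) (h2 : 3 ∣ β₂) (h3 : 3 ∣ β₃) (hγ : 3 ∣ γ₁)
    (hγ₂ : γ₂ % 3 = 2) (lα : α < γ₂) (l1 : β₁ < γ₂) (l2 : β₂ < γ₂) (l3 : β₃ < γ₂) (l4 : γ₁ < γ₂) :
    Set.ncard {x : K | 1 + (x ^ q - x) ^ α + (x ^ q - x) ^ β₁ + 2 * (x ^ q - x) ^ β₂ +
      (x ^ q - x) ^ β₃ + (x ^ q - x) ^ γ₁ + (x ^ q - x) ^ γ₂ = 0} = q * γ₂ := by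
  set P : K[X] := 1 + X ^ α + X ^ β₁ + 2 * X ^ β₂ + X ^ β₃ + X ^ γ₁ + X ^ γ₂ with hP
  have c3 : ∀ n : ℕ, 3 ∣ n → (n : K) = 0 := fun n hn => (CharP.cast_eq_zero_iff K 3 n).mpr hn
  have hq1 : 1 < q := by rw [hq]; exact Nat.one_lt_pow (by omega) (by omega)
  have hqc : (q : K) = 0 := c3 q (by rw [hq]; exact dvd_pow_self 3 (by omega))
  have dP : derivative P = C (γ₂ : K) * X ^ (γ₂ - 1) := by
    simp [hP, derivative_X_pow, c3 _ hα, c3 _ h1, c3 _ h2, c3 _ h3, c3 _ hγ]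
  have hγc : (γ₂ : K) ≠ 0 := by
    intro h
    have := (CharP.cast_eq_zero_iff K 3 γ₂).mp h
    omega
  have hsep : IsCoprime P (derivative P) := by
    rw [dP]
    have hX : IsCoprime P (X : K[X]) := by
      have e : ∀ n : ℕ, 0 < n → (X : K[X]) ^ n = X * X ^ (n - 1) := fun n hn => by
        rw [← pow_succ']; congr 1; omega
      refine ⟨1, -(X ^ (α-1) + X ^ (β₁-1) + 2 * X ^ (β₂-1) + X ^ (β₃-1) + X ^ (γ₁-1) + X ^ (γ₂-1)), ?_⟩
      rw [hP, e α hα0, e β₁ h10, e β₂ h20, e β₃ h30, e γ₁ hγ0, e γ₂ (by omega)]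
      ring
    refine IsCoprime.mul_right ?_ hX.pow_right
    exact ⟨0, C (γ₂ : K)⁻¹, by rw [← C_mul, inv_mul_cancel₀ hγc]; simp⟩
  set g : K[X] := X ^ q - X with hg
  have dg : derivative g = -1 := by
    simp [hg, derivative_X_pow, hqc]
  have hsepQ : (P.comp g).Separable := by
    unfold Polynomial.Separable
    rw [derivative_comp, dg]
    have := hsep.map (compRingHom g)
    simp only [coe_compRingHom] at this
    simpa using this.neg_right
  have ndP : P.natDegree = γ₂ := by
    have : (1 + X ^ α + X ^ β₁ + 2 * X ^ β₂ + X ^ β₃ + X ^ γ₁ : K[X]).natDegree ≤ γ₂ - 1 := by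
      compute_degree
      omega
    rw [hP, natDegree_add_eq_right_of_natDegree_lt]
    · simp
    · rw [natDegree_X_pow]; omega
  have ndg : g.natDegree = q := by
    rw [hg, natDegree_sub_eq_left_of_natDegree_lt] <;> simp [hq1]
  have nd : (P.comp g).natDegree = q * γ₂ := by
    rw [natDegree_comp, ndP, ndg]; ring
  have hne : P.comp g ≠ 0 := hsepQ.ne_zero
  have := card_rootSet_eq_natDegree (K := K) hsepQ (IsAlgClosed.splits _)
  rw [nd] at this
  rw [← this, ← Nat.card_eq_fintype_card, Nat.card_coe_set_eq]
  congr 1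
  ext x
  rw [mem_rootSet, and_iff_right hne, Set.mem_setOf_eq, coe_aeval_eq_eval, eval_comp]
  simp [hP, hg]

end Poly
end SkReeAux

namespace SkReeAux
section Count

theorem expo (s q₀ q : ℕ) (hs : 1 ≤ s) (hq₀ : q₀ = 3 ^ s) (hq : q = 3 * q₀ ^ 2) :
    ∃ α β₁ β₂ β₃ γ₁ γ₂ : ℕ,
      (0 < α ∧ 0 < β₁ ∧ 0 < β₂ ∧ 0 < β₃ ∧ 0 < γ₁) ∧
      (3 ∣ α ∧ 3 ∣ β₁ ∧ 3 ∣ β₂ ∧ 3 ∣ β₃ ∧ 3 ∣ γ₁) ∧ γ₂ % 3 = 2 ∧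
      (α < γ₂ ∧ β₁ < γ₂ ∧ β₂ < γ₂ ∧ β₃ < γ₂ ∧ γ₁ < γ₂) ∧
      γ₂ + 1 + 2 * q + 3 * q₀ = 3 * q₀ * q ^ 2 + q ^ 3 + q ^ 2 + q ∧
      ∀ (K : Type _) [Field K] (w : K),
        pt (fun i => w ^ (q ^ i)) (fun i => w ^ (3 * q₀ * q ^ i)) 0 4 6 =
        w ^ (1 + 3*q₀ + 2*q + 3*q₀*q + q^2) *
          (1 + w ^ α + w ^ β₁ + 2 * w ^ β₂ + w ^ β₃ + w ^ γ₁ + w ^ γ₂) := by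
  have h3 : 3 ≤ q₀ := by
    rw [hq₀]; calc 3 = 3 ^ 1 := by norm_num
      _ ≤ 3 ^ s := Nat.pow_le_pow_right (by norm_num) hs
  have d0 : 3 ∣ q₀ := by rw [hq₀]; exact dvd_pow_self 3 (by omega)
  have d1 : 3 ∣ q := ⟨_, hq⟩
  have d2 : 3 ∣ q ^ 2 := dvd_pow d1 (by norm_num)
  have d3 : 3 ∣ q ^ 3 := dvd_pow d1 (by norm_num)
  have d4 : 3 ∣ 3 * q₀ * q := ⟨q₀ * q, by ring⟩
  have d5 : 3 ∣ 3 * q₀ * q ^ 2 := ⟨q₀ * q ^ 2, by ring⟩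
  have hqq : 3 * (3 * q₀) ≤ 3 * q := by rw [hq]; nlinarith
  have l1 : 9 * q ≤ q ^ 2 := by nlinarith
  have l2 : 9 * q ^ 2 ≤ q ^ 3 := by
    have : q ^ 3 = q * q ^ 2 := by ring
    rw [this]; exact Nat.mul_le_mul_right _ (by omega)
  have l3 : 9 * (3 * q₀ * q) ≤ 3 * q₀ * q ^ 2 := by
    have : 3 * q₀ * q ^ 2 = q * (3 * q₀ * q) := by ring
    rw [this]; exact Nat.mul_le_mul_right _ (by omega)
  have l4 : q ≤ 3 * q₀ * q := Nat.le_mul_of_pos_left _ (by omega)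
  have l5 : 3 * q₀ * q ≤ q ^ 2 := by
    have : q ^ 2 = q * q := by ring
    rw [this]; exact Nat.mul_le_mul_right _ (by omega)
  have hq9 : 9 ≤ q := by omega
  obtain ⟨A, hA⟩ : ∃ A, A = q ^ 2 := ⟨_, rfl⟩
  obtain ⟨B, hB⟩ : ∃ B, B = q ^ 3 := ⟨_, rfl⟩
  obtain ⟨U, hU⟩ : ∃ U, U = 3 * q₀ * q := ⟨_, rfl⟩
  obtain ⟨V, hV⟩ : ∃ V, V = 3 * q₀ * q ^ 2 := ⟨_, rfl⟩
  simp only [← hV] at d5 l3 ⊢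
  simp only [← hA, ← hB, ← hU] at d2 d3 d4 l1 l2 l3 l4 l5 ⊢
  have key : ∀ (K : Type _) [Field K] (w : K), pt (fun i => w ^ (q ^ i)) (fun i => w ^ (3 * q₀ * q ^ i)) 0 4 6
      = w^(1+3*q₀+2*q+U+A) + w^(1+3*q₀+2*q+U+B) + w^(1+3*q₀+2*q+V+B) + 2*w^(1+3*q₀+q+A+V+B)
        + w^(1+3*q₀+2*A+V+B) + w^(1+U+2*A+V+B)+ w^(q+U+2*A+V+B) := by
    intro K _ w
    rw [D4]
    simp only [zero_add, pow_zero, pow_one, mul_one, hA, hB, hU, hV]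
    ring
  refine ⟨B - A, V + B - A - U, V + B - q - U, V + B + A - 2 * q - U, V + B + A - 2 * q - 3 * q₀,
    V + B + A - q - 3 * q₀ - 1, ?_, ?_, ?_, ?_, ?_, ?_⟩
  · omega
  · omega
  · omega
  · omega
  · omega
  · intro K _ w
    rw [key]
    simp only [mul_add, mul_one, ← pow_add, mul_left_comm _ (2 : K)]
    congr 1
    · congr 1
      · congr 1
        · congr 1
          · congr 1
            · congr 1
              congr 1; omega
            · congr 1; omega
          · congr 2; omega
        · congr 1; omega
      · congr 1; omega
    · congr 1; omega

end Count
end SkReeAux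

namespace SkReeAux
section Fib
open Polynomial

theorem ncard_root_le {F : Type*} [Field F] (p : F[X]) (hp : p ≠ 0) :
    Set.ncard {x : F | p.eval x = 0} ≤ p.natDegree := by
  classical
  have : {x : F | p.eval x = 0} = (p.roots.toFinset : Set F) := by
    ext x; simp [hp]
  rw [this, Set.ncard_coe_finset]
  exact (Multiset.toFinset_card_le _).trans (card_roots' p)

theorem fib {F : Type*} [Field F] [Fintype F] [CharP F 3] (q k : ℕ) (hq : q = 3 ^ (k + 1))
    (hF : Fintype.card F = q ^ 6) (c : F) :
    (∑ i ∈ Finset.range 6, c ^ (q ^ i) = 0 → Set.ncard {y : F | y ^ q - y = c} = q) ∧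
    ((∃ y : F, y ^ q - y = c) → ∑ i ∈ Finset.range 6, c ^ (q ^ i) = 0) := by
  have hq1 : 1 < q := by rw [hq]; exact Nat.one_lt_pow (by omega) (by omega)
  have hfr : ∀ i, ∀ x y : F, (x + y) ^ (q ^ i) = x ^ (q ^ i) + y ^ (q ^ i) := fun i x y => by
    rw [hq, ← pow_mul]; exact add_pow_expChar_pow x y 3 _
  have hfs : ∀ i, ∀ x y : F, (x - y) ^ (q ^ i) = x ^ (q ^ i) - y ^ (q ^ i) := fun i x y => by
    rw [hq, ← pow_mul]; exact sub_pow_char_pow x y _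
  have hfr1 : ∀ x y : F, (x + y) ^ q = x ^ q + y ^ q := fun x y => by
    simpa using hfr 1 x y
  have tr0 : ∀ y : F, ∑ i ∈ Finset.range 6, (y ^ q - y) ^ (q ^ i) = 0 := by
    intro y
    have h1 : ∀ i, (y ^ q - y) ^ (q ^ i) = y ^ (q ^ (i + 1)) - y ^ (q ^ i) := fun i => by
      rw [hfs, ← pow_mul, pow_succ']
    simp only [h1]
    rw [Finset.sum_range_sub (fun i => y ^ (q ^ i)), ← hF, FiniteField.pow_card]
    simp
  let L : F →+ F :=
    { toFun := fun y => y ^ q - y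
      map_zero' := by simp [show q ≠ 0 by omega]
      map_add' := fun x y => by rw [hfr1]; ring }
  have hL : ∀ y, L y = y ^ q - y := fun _ => rfl
  have kle : Nat.card L.ker ≤ q := by
    have h1 := ncard_root_le (X ^ q - X : F[X]) (FiniteField.X_pow_card_sub_X_ne_zero F hq1)
    rw [FiniteField.X_pow_card_sub_X_natDegree_eq F hq1] at h1
    refine le_trans (le_of_eq ?_) h1
    rw [← Nat.card_coe_set_eq]
    refine Nat.card_congr (Equiv.subtypeEquivRight fun x => ?_)
    simp [AddMonoidHom.mem_ker, hL]
  set T : F[X] := ∑ i ∈ Finset.range 6, X ^ (q ^ i) with hT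
  have Tc : T.coeff 1 = 1 := by
    rw [hT, finsetSum_coeff, Finset.sum_eq_single 0]
    · simp
    · intro i _ hi
      rw [coeff_X_pow, if_neg]
      exact (Nat.one_lt_pow hi hq1).ne
    · simp
  have Tne : T ≠ 0 := by
    intro h; rw [h] at Tc; simp at Tc
  have Td : T.natDegree ≤ q ^ 5 := by
    rw [hT]
    refine natDegree_sum_le_of_forall_le _ _ fun i hi => ?_
    rw [natDegree_X_pow]
    exact Nat.pow_le_pow_right (by omega) (by have := Finset.mem_range.mp hi; omega)
  have Te : ∀ x : F, T.eval x = ∑ i ∈ Finset.range 6, x ^ (q ^ i) := fun x => by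
    simp [hT, eval_finsetSum]
  have Tle : Set.ncard {x : F | T.eval x = 0} ≤ q ^ 5 := (ncard_root_le T Tne).trans Td
  have rsub : (L.range : Set F) ⊆ {x : F | T.eval x = 0} := by
    rintro _ ⟨y, rfl⟩
    change T.eval _ = 0
    rw [Te, hL, tr0]
  have rle : Nat.card L.range = Set.ncard (L.range : Set F) := Nat.card_coe_set_eq _
  have rle2 : Set.ncard (L.range : Set F) ≤ Set.ncard {x : F | T.eval x = 0} :=
    Set.ncard_le_ncard rsub (Set.toFinite _)
  have prod : Nat.card L.ker * Nat.card L.range = q ^ 6 := by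
    rw [← AddSubgroup.index_ker, AddSubgroup.card_mul_index, Nat.card_eq_fintype_card, hF]
  have req : q ^ 5 ≤ Nat.card L.range := by
    have : q * q ^ 5 ≤ q * Nat.card L.range := by
      calc q * q ^ 5 = q ^ 6 := by ring
        _ = _ := prod.symm
        _ ≤ _ := Nat.mul_le_mul_right _ kle
    exact Nat.le_of_mul_le_mul_left this (by omega)
  have req' : Nat.card L.range = q ^ 5 := le_antisymm (by omega) req
  have keq : Nat.card L.ker = q := by
    rw [req'] at prod
    have : Nat.card L.ker * q ^ 5 = q * q ^ 5 := by rw [prod]; ring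
    exact Nat.eq_of_mul_eq_mul_right (by positivity) this
  have seteq : (L.range : Set F) = {x : F | T.eval x = 0} :=
    Set.eq_of_subset_of_ncard_le rsub (by omega) (Set.toFinite _)
  constructor
  · intro hc
    have : c ∈ (L.range : Set F) := by
      rw [seteq]; change T.eval c = 0; rw [Te]; exact hc
    obtain ⟨y₀, hy₀⟩ := this
    refine Eq.trans ?_ keq
    rw [← Nat.card_coe_set_eq]
    refine Nat.card_congr ((Equiv.subRight y₀).subtypeEquiv fun y => ?_)
    rw [AddMonoidHom.mem_ker]
    change _ ↔ L (y - y₀) = 0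
    rw [map_sub, hy₀, sub_eq_zero]
    rfl
  · rintro ⟨y, rfl⟩
    exact tr0 y

theorem mfib {F : Type*} [Field F] [Fintype F] (m N : ℕ) (hm : 0 < m)
    (hF : Fintype.card F = m * N + 1) (w : F) (hw : w ≠ 0) (hN : w ^ N = 1) :
    Set.ncard {t : F | t ^ m = w} = m := by
  classical
  obtain ⟨g, hg⟩ := IsCyclic.exists_generator (α := Fˣ)
  have og : orderOf g = m * N := by
    rw [orderOf_eq_card_of_forall_mem_zpowers hg, Nat.card_eq_fintype_card, Fintype.card_units, hF]; simp
  have hN0 : 0 < N := by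
    rcases Nat.eq_zero_or_pos N with h | h
    · subst h
      have := Fintype.one_lt_card (α := F)
      omega
    · exact h
  have hζ : IsPrimitiveRoot ((g ^ N : Fˣ) : F) m := by
    rw [IsPrimitiveRoot.coe_units_iff]
    have := IsPrimitiveRoot.orderOf g
    rw [og] at this
    exact this.pow (by positivity) (by ring)
  have hex : ∃ a : F, a ^ m = w := by
    obtain ⟨n, hn⟩ := (mem_powers_iff_mem_zpowers.mpr (hg (Units.mk0 w hw)))
    have hn : g ^ n = Units.mk0 w hw := hn
    have h1 : g ^ (n * N) = 1 := by
      rw [pow_mul, hn]; ext; simpa using hN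
    have h2 := orderOf_dvd_of_pow_eq_one h1
    rw [og] at h2
    obtain ⟨r, hr⟩ := Nat.dvd_of_mul_dvd_mul_right hN0 h2
    refine ⟨((g ^ r : Fˣ) : F), ?_⟩
    have : (g ^ r) ^ m = Units.mk0 w hw := by rw [← hn, hr, ← pow_mul]; congr 1; ring
    rw [← Units.val_pow_eq_pow_val, this]; rfl
  have h1 := hζ.card_nthRoots w
  rw [if_pos hex] at h1
  have h2 := hζ.nthRoots_nodup hw
  have : {t : F | t ^ m = w} = ((nthRoots m w).toFinset : Set F) := by
    ext t; simp [mem_nthRoots hm]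
  rw [this, Set.ncard_coe_finset, Multiset.toFinset_card_of_nodup h2, h1]

end Fib
end SkReeAux

namespace SkReeAux
section Fin
open Polynomial

theorem mem_range_of_pow {F K : Type*} [Field F] [Fintype F] [Field K] [Algebra F K] (n : ℕ)
    (hF : Fintype.card F = n) (x : K) (hx : x ^ n = x) : ∃ y : F, algebraMap F K y = x := by
  classical
  have hn1 : 1 < n := by rw [← hF]; exact Fintype.one_lt_card
  have hinj := (algebraMap F K).injective
  have h1 := ncard_root_le (X ^ n - X : K[X]) (FiniteField.X_pow_card_sub_X_ne_zero K hn1)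
  rw [FiniteField.X_pow_card_sub_X_natDegree_eq K hn1] at h1
  have fin : Set.Finite {x : K | (X ^ n - X : K[X]).eval x = 0} := by
    refine Set.Finite.subset (X ^ n - X : K[X]).roots.toFinset.finite_toSet ?_
    intro x hx
    simpa [FiniteField.X_pow_card_sub_X_ne_zero K hn1] using hx
  have hsub : Set.range (algebraMap F K) ⊆ {x : K | (X ^ n - X : K[X]).eval x = 0} := by
    rintro _ ⟨y, rfl⟩
    change (X ^ n - X : K[X]).eval _ = 0
    simp only [eval_sub, eval_pow, eval_X, ← map_pow, ← hF, FiniteField.pow_card, sub_self]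
  have hc : Set.ncard (Set.range (algebraMap F K)) = n := by
    rw [← Set.image_univ, Set.ncard_image_of_injective _ hinj, Set.ncard_univ,
      Nat.card_eq_fintype_card, hF]
  have heq := Set.eq_of_subset_of_ncard_le hsub (by omega) fin
  have : x ∈ Set.range (algebraMap F K) := by
    rw [heq]; change (X ^ n - X : K[X]).eval _ = 0
    simp [hx]
  exact this

theorem G_count (s q₀ q : ℕ) (hs : 1 ≤ s) (hq₀ : q₀ = 3 ^ s) (hq : q = 3 * q₀ ^ 2)
    (F : Type*) [Field F] [Fintype F] [CharP F 3] (hF : Fintype.card F = q ^ 6) :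
    ∃ γ₂ : ℕ, γ₂ + 1 + 2 * q + 3 * q₀ = 3 * q₀ * q ^ 2 + q ^ 3 + q ^ 2 + q ∧
    Set.ncard {x : F | x ^ q - x ≠ 0 ∧
      ∑ i ∈ Finset.range 6, (x ^ q₀ * (x ^ q - x)) ^ (q ^ i) = 0 ∧
      ∑ i ∈ Finset.range 6, (x ^ (2 * q₀) * (x ^ q - x)) ^ (q ^ i) = 0} = q * γ₂ := by
  obtain ⟨α, β₁, β₂, β₃, γ₁, γ₂, ⟨p1, p2, p3, p4, p5⟩, ⟨d1, d2, d3, d4, d5⟩, hm, ⟨l1, l2, l3, l4, l5⟩,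
    hγ, hD⟩ := expo s q₀ q hs hq₀ hq
  refine ⟨γ₂, hγ, ?_⟩
  have hq' : q = 3 ^ (2 * s + 1) := by rw [hq, hq₀]; ring
  let K := AlgebraicClosure F
  have : CharP K 3 := charP_of_injective_algebraMap (algebraMap F K).injective 3
  have hinj := (algebraMap F K).injective
  rw [← poly_count K q (2 * s) α β₁ β₂ β₃ γ₁ γ₂ hq' p1 p2 p3 p4 p5 d1 d2 d3 d4 d5 hm l1 l2 l3 l4 l5,
    ← Set.ncard_image_of_injective _ hinj]
  congr 1
  ext x
  constructor
  · rintro ⟨y, ⟨hy, h1, h2⟩, rfl⟩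
    have hw : (algebraMap F K y) ^ q - algebraMap F K y ≠ 0 := by
      rw [← map_pow, ← map_sub]
      exact (map_ne_zero_iff _ hinj).mpr hy
    have h := (main_iff s q₀ q hq₀ hq (algebraMap F K y) hw).1.mpr ⟨?_, ?_, ?_⟩
    · rw [hD] at h
      exact (mul_eq_zero.mp h).resolve_left (pow_ne_zero _ hw)
    · rw [← map_pow, ← hF, FiniteField.pow_card]
    · simp only [← map_pow, ← map_sub, ← map_mul, ← map_sum, h1, map_zero]
    · simp only [← map_pow, ← map_sub, ← map_mul, ← map_sum, h2, map_zero]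
  · intro hx
    have hx : 1 + (x ^ q - x) ^ α + (x ^ q - x) ^ β₁ + 2 * (x ^ q - x) ^ β₂ +
      (x ^ q - x) ^ β₃ + (x ^ q - x) ^ γ₁ + (x ^ q - x) ^ γ₂ = 0 := hx
    have hw : x ^ q - x ≠ 0 := by
      intro h
      rw [h] at hx
      simp [p1.ne', p2.ne', p3.ne', p4.ne', p5.ne', show γ₂ ≠ 0 by omega] at hx
    obtain ⟨hx6, h1, h2⟩ := (main_iff s q₀ q hq₀ hq x hw).1.mp (by rw [hD, hx, mul_zero])
    obtain ⟨y, rfl⟩ := mem_range_of_pow (F := F) _ hF x hx6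
    refine ⟨y, ⟨?_, ?_, ?_⟩, rfl⟩
    · intro h
      apply hw
      rw [← map_pow, ← map_sub, h, map_zero]
    · apply hinj
      simpa only [map_pow, map_sub, map_mul, map_sum, map_zero] using h1
    · apply hinj
      simpa only [map_pow, map_sub, map_mul, map_sum, map_zero] using h2

end Fin
end SkReeAux

/-- The Skabelund curve `R̃_q` has exactly `q⁷ - q⁶ + q⁴` affine
`F_{q⁶}`-rational points. -/
theorem skabelund_ree_affine_point_count
    (s : ℕ) (hs : 1 ≤ s) (q₀ q m : ℕ)
    (hq₀ : q₀ = 3 ^ s) (hq : q = 3 * q₀ ^ 2) (hm : m = q - 3 * q₀ + 1)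
    (F : Type*) [Field F] [Fintype F] (hF : Fintype.card F = q ^ 6) :
    Nat.card {p : F × F × F × F |
        p.2.1 ^ q - p.2.1 = p.1 ^ q₀ * (p.1 ^ q - p.1) ∧
        p.2.2.1 ^ q - p.2.2.1 = p.1 ^ (2 * q₀) * (p.1 ^ q - p.1) ∧
        p.2.2.2 ^ m = p.1 ^ q - p.1} = q ^ 7 - q ^ 6 + q ^ 4 := by
  classical
  have hq' : q = 3 ^ (2 * s + 1) := by rw [hq, hq₀]; ring
  have : CharP F 3 := by
    obtain ⟨p, hp⟩ := CharP.exists F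
    have := hp
    obtain ⟨n, hpp, hn⟩ := FiniteField.card F p
    have h3 : p ∣ 3 ^ ((2 * s + 1) * 6) := by
      rw [pow_mul, ← hq', ← hF, hn]; exact dvd_pow_self p n.2.ne'
    have := (Nat.prime_dvd_prime_iff_eq hpp Nat.prime_three).mp (hpp.dvd_of_dvd_pow h3)
    subst this
    exact hp
  have h3 : 3 ≤ q₀ := by
    rw [hq₀]; calc 3 = 3 ^ 1 := by norm_num
      _ ≤ 3 ^ s := Nat.pow_le_pow_right (by norm_num) hs
  have hqq : 3 * q₀ ≤ q := by rw [hq]; nlinarith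
  obtain ⟨γ₂, hγ, hG⟩ := SkReeAux.G_count s q₀ q hs hq₀ hq F hF
  have hmZ : (m : ℤ) = q - 3 * q₀ + 1 := by omega
  have hqZ : (q : ℤ) = 3 * q₀ ^ 2 := by exact_mod_cast hq
  have hγZ : (γ₂ : ℤ) = (q ^ 2 - 1) * (q + 3 * q₀ + 1) := by
    have : (γ₂ : ℤ) + 1 + 2 * q + 3 * q₀ = 3 * q₀ * q ^ 2 + q ^ 3 + q ^ 2 + q := by exact_mod_cast hγ
    linear_combination this
  have hmm : ((m : ℤ)) * (q + 3 * q₀ + 1) = q ^ 2 - q + 1 := by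
    rw [hmZ]; linear_combination (3 : ℤ) * hqZ
  set M := 1 + 3*q₀ + 2*q + 3*q₀*q + q^2 with hM
  have hMm : m * M = q ^ 3 + 1 := by
    zify
    have : (M : ℤ) = (q + 1) * (q + 3 * q₀ + 1) := by rw [hM]; push_cast; ring
    rw [this]
    linear_combination ((q : ℤ) + 1) * hmm
  have hq3 : 1 ≤ q ^ 3 := Nat.one_le_pow _ _ (by omega)
  have hcard : Fintype.card F = m * (M * (q ^ 3 - 1)) + 1 := by
    rw [hF, ← mul_assoc, hMm]
    zify [hq3]; ring
  have hfib := SkReeAux.fib (F := F) q (2 * s) hq' hF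

  let A : F → Set F := fun x => {y | y ^ q - y = x ^ q₀ * (x ^ q - x)}
  let B : F → Set F := fun x => {y | y ^ q - y = x ^ (2 * q₀) * (x ^ q - x)}
  let C : F → Set F := fun x => {t | t ^ m = x ^ q - x}
  let S0 : Set F := {x | x ^ q - x = 0}
  let G : Set F := {x : F | x ^ q - x ≠ 0 ∧
      ∑ i ∈ Finset.range 6, (x ^ q₀ * (x ^ q - x)) ^ (q ^ i) = 0 ∧
      ∑ i ∈ Finset.range 6, (x ^ (2 * q₀) * (x ^ q - x)) ^ (q ^ i) = 0}
  have hG : G.ncard = q * γ₂ := hG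
  have z0 : ∑ i ∈ Finset.range 6, (0 : F) ^ (q ^ i) = 0 := by
    apply Finset.sum_eq_zero
    intro i _
    exact zero_pow (pow_pos (by omega) i).ne'
  have hS0 : S0.ncard = q := (hfib 0).1 z0
  have hsig : Nat.card {p : F × F × F × F |
        p.2.1 ^ q - p.2.1 = p.1 ^ q₀ * (p.1 ^ q - p.1) ∧
        p.2.2.1 ^ q - p.2.2.1 = p.1 ^ (2 * q₀) * (p.1 ^ q - p.1) ∧
        p.2.2.2 ^ m = p.1 ^ q - p.1} = ∑ x : F, (A x).ncard * ((B x).ncard * (C x).ncard) := by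
    have e : {p : F × F × F × F |
        p.2.1 ^ q - p.2.1 = p.1 ^ q₀ * (p.1 ^ q - p.1) ∧
        p.2.2.1 ^ q - p.2.2.1 = p.1 ^ (2 * q₀) * (p.1 ^ q - p.1) ∧
        p.2.2.2 ^ m = p.1 ^ q - p.1} ≃ (Σ x : F, (A x × (B x × C x))) :=
      { toFun := fun p => ⟨p.1.1, ⟨p.1.2.1, p.2.1⟩, ⟨p.1.2.2.1, p.2.2.1⟩, ⟨p.1.2.2.2, p.2.2.2⟩⟩
        invFun := fun p => ⟨(p.1, p.2.1.1, p.2.2.1.1, p.2.2.2.1), p.2.1.2, p.2.2.1.2, p.2.2.2.2⟩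
        left_inv := fun _ => rfl
        right_inv := fun _ => rfl }
    rw [Nat.card_congr e, Nat.card_sigma]
    refine Finset.sum_congr rfl fun x _ => ?_
    rw [Nat.card_prod, Nat.card_prod]
    simp only [Nat.card_coe_set_eq]
  have hm0 : 0 < m := by omega
  have hval : ∀ x : F, (A x).ncard * ((B x).ncard * (C x).ncard) =
      (if x ∈ S0 then q ^ 2 else 0) + (if x ∈ G then q ^ 2 * m else 0) := by
    intro x
    by_cases hx : x ^ q - x = 0
    · have i1 : x ∈ S0 := hx
      have i2 : x ∉ G := fun h => h.1 hx
      rw [if_pos i1, if_neg i2]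
      have a : (A x).ncard = q := (hfib _).1 (by rw [hx, mul_zero, z0])
      have b : (B x).ncard = q := (hfib _).1 (by rw [hx, mul_zero, z0])
      have c : (C x) = {0} := by
        ext t
        change t ^ m = x ^ q - x ↔ t = 0
        rw [hx, pow_eq_zero_iff hm0.ne']
      rw [a, b, c, Set.ncard_singleton]; ring
    · have i1 : x ∉ S0 := hx
      rw [if_neg i1]
      by_cases hg : x ∈ G
      · rw [if_pos hg]
        obtain ⟨_, h1, h2⟩ := hg
        have a : (A x).ncard = q := (hfib _).1 h1
        have b : (B x).ncard = q := (hfib _).1 h2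
        have c : (C x).ncard = m := by
          refine SkReeAux.mfib m _ hm0 hcard _ hx ?_
          have h := (SkReeAux.main_iff s q₀ q hq₀ hq x hx).2
            (by rw [← hF, FiniteField.pow_card]) h1 h2
          rw [← hM] at h
          have e : M * q ^ 3 = M * (q ^ 3 - 1) + M := by
            obtain ⟨r, hr⟩ := Nat.exists_eq_add_of_le hq3
            rw [hr, Nat.add_sub_cancel_left]; ring
          rw [e, pow_add] at h
          exact mul_right_cancel₀ (pow_ne_zero M hx) (h.trans (one_mul _).symm)
        rw [a, b, c]; ring
      · rw [if_neg hg]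
        by_cases h1 : ∑ i ∈ Finset.range 6, (x ^ q₀ * (x ^ q - x)) ^ (q ^ i) = 0
        · have h2 : ¬ ∑ i ∈ Finset.range 6, (x ^ (2 * q₀) * (x ^ q - x)) ^ (q ^ i) = 0 :=
            fun h2 => hg ⟨hx, h1, h2⟩
          have b : B x = ∅ := Set.eq_empty_iff_forall_notMem.mpr fun y hy =>
            h2 ((hfib _).2 ⟨y, hy⟩)
          rw [b]; simp
        · have a : A x = ∅ := Set.eq_empty_iff_forall_notMem.mpr fun y hy =>
            h1 ((hfib _).2 ⟨y, hy⟩)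
          rw [a]; simp
  rw [hsig, Finset.sum_congr rfl fun x _ => hval x, Finset.sum_add_distrib]
  have ssum : ∀ (S : Set F) [DecidablePred (· ∈ S)] (c : ℕ), ∑ x : F, (if x ∈ S then c else 0) = S.ncard * c := by
    intro S _ c
    rw [← Finset.sum_filter, Finset.sum_const, smul_eq_mul, Set.ncard_eq_toFinset_card']
    congr 2
    ext; simp
  rw [ssum, ssum, hS0, hG]
  have h76 : q ^ 6 ≤ q ^ 7 := Nat.pow_le_pow_right (by omega) (by omega)
  zify [h76]
  rw [hγZ]
  linear_combination ((q : ℤ) ^ 3 * (q ^ 2 - 1)) * hmm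
end

section
/- Let s ≥ 1, q₀ = 3^s, q = 3q₀², m = q − 3q₀ + 1, and let F be a finite field of characteristic 3 whose cardinality is q, q², or q³. Then a quadruple (x, y, z, t) ∈ F⁴ satisfies y^q − y = x^{q₀}(x^q − x), z^q − z = x^{2q₀}(x^q − x), and t^m = x^q − x if and only if x^q = x, y^q = y, z^q = z, and t = 0; in particular the number of such quadruples is q³. -/
open Polynomial in
theorem skab_card_fixed (F : Type*) [Field F] [Fintype F] [CharP F 3] (q k : ℕ)
    (h3 : 3 ∣ q) (hq1 : 1 < q) (hF : Fintype.card F = q ^ k) :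
    Nat.card {x : F | x ^ q = x} = q := by
  have hsep : Separable (X ^ q - X : F[X]) := galois_poly_separable 3 q h3
  have hsplit : Splits (X ^ q - X : F[X]) := by
    have h := Polynomial.splits_X_pow_nat_card_sub_X (K := F)
    rw [Nat.card_eq_fintype_card] at h
    refine h.of_dvd (FiniteField.X_pow_card_sub_X_ne_zero F Fintype.one_lt_card) ?_
    rw [hF]
    have := dvd_pow_pow_sub_self_of_dvd (r := (X : F[X])) (p := q) (one_dvd k)
    rwa [pow_one] at this
  have h := card_rootSet_eq_natDegree (K := F) hsep (by simpa using hsplit)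
  rw [FiniteField.X_pow_card_sub_X_natDegree_eq F hq1, ← Nat.card_eq_fintype_card] at h
  have hs : {x : F | x ^ q = x} = (X ^ q - X : F[X]).rootSet F := by
    ext x
    simp [mem_rootSet, FiniteField.X_pow_card_sub_X_ne_zero F hq1, sub_eq_zero]
  rw [hs]
  exact h

theorem skab_key (F : Type*) [Field F] [Fintype F] [CharP F 3] (s n : ℕ)
    (hF : Fintype.card F = 3 ^ n ∨ Fintype.card F = (3 ^ n) ^ 2 ∨
      Fintype.card F = (3 ^ n) ^ 3) (x y z : F)
    (hy : y ^ 3 ^ n - y = x ^ 3 ^ s * (x ^ 3 ^ n - x))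
    (hz : z ^ 3 ^ n - z = x ^ (2 * 3 ^ s) * (x ^ 3 ^ n - x)) : x ^ 3 ^ n = x := by
  have : Fact (Nat.Prime 3) := ⟨Nat.prime_three⟩
  have hinj : ∀ a b : F, a ^ 3 ^ s = b ^ 3 ^ s → a = b := fun a b h =>
    iterateFrobenius_inj F 3 s (by simpa [iterateFrobenius_def] using h)
  have hcomm : ∀ a : F, (a ^ 3 ^ n) ^ 3 ^ s = (a ^ 3 ^ s) ^ 3 ^ n := fun a => pow_right_comm _ _ _
  have hz' : z ^ 3 ^ n - z = (x ^ 3 ^ s) ^ 2 * (x ^ 3 ^ n - x) := by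
    rw [hz, mul_comm 2, pow_mul]
  obtain ⟨φ, hφ⟩ : ∃ φ : F →+* F, ∀ a, a ^ 3 ^ n = φ a :=
    ⟨iterateFrobenius F 3 n, fun a => by rw [iterateFrobenius_def]⟩
  obtain ⟨ψ, hψ⟩ : ∃ ψ : F →+* F, ∀ a, a ^ 3 ^ s = ψ a :=
    ⟨iterateFrobenius F 3 s, fun a => by rw [iterateFrobenius_def]⟩
  have hc := fun a : F => FiniteField.pow_card a
  rcases hF with h | h | h
  · rw [← h]; exact hc x
  · rw [h] at hc
    simp only [pow_two (3 ^ n), pow_mul, hφ] at hc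
    simp only [hφ, hψ] at *
    have h1 := congrArg φ hy
    simp only [map_sub, map_mul, hc, ← hcomm] at h1
    have h2 : (ψ (φ x) - ψ x) * (φ x - x) = 0 := by linear_combination hy + h1
    rcases mul_eq_zero.mp h2 with h2 | h2
    · exact hinj _ _ (sub_eq_zero.mp h2)
    · exact sub_eq_zero.mp h2
  · rw [h] at hc
    simp only [pow_succ (3 ^ n), pow_zero, one_mul, pow_mul, hφ] at hc
    simp only [hφ, hψ] at *
    have h1 := congrArg φ hy
    have h1' := congrArg φ h1
    have h2 := congrArg φ hz'
    have h2' := congrArg φ h2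
    simp only [map_sub, map_mul, map_pow, hc, ← hcomm] at h1 h1' h2 h2'
    have h3 : (φ x - x) * ((ψ x - ψ (φ x)) * (ψ x - ψ (φ (φ x)))) = 0 := by
      linear_combination (ψ (φ x) + ψ (φ (φ x))) * (hy + h1 + h1') - (hz' + h2 + h2')
    rcases mul_eq_zero.mp h3 with h3 | h3
    · exact sub_eq_zero.mp h3
    rcases mul_eq_zero.mp h3 with h3 | h3
    · exact (hinj _ _ (sub_eq_zero.mp h3)).symm
    · have h4 := hinj _ _ (sub_eq_zero.mp h3)
      have h5 := congrArg φ h4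
      rwa [hc] at h5

/-- Over `F_q`, `F_{q²}` and `F_{q³}`, the affine points of the Skabelund curve
`R̃_q` are exactly the `q³` points with coordinates in `F_q` and `t = 0`. -/
theorem skabelund_ree_rational_points_small_fields
    (s : ℕ) (hs : 1 ≤ s) (q₀ q m : ℕ)
    (hq₀ : q₀ = 3 ^ s) (hq : q = 3 * q₀ ^ 2) (hm : m = q - 3 * q₀ + 1)
    (F : Type*) [Field F] [Fintype F] [CharP F 3]
    (hF : Fintype.card F = q ∨ Fintype.card F = q ^ 2 ∨ Fintype.card F = q ^ 3) :
    (∀ x y z t : F,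
      (y ^ q - y = x ^ q₀ * (x ^ q - x) ∧
       z ^ q - z = x ^ (2 * q₀) * (x ^ q - x) ∧
       t ^ m = x ^ q - x) ↔
      (x ^ q = x ∧ y ^ q = y ∧ z ^ q = z ∧ t = 0)) ∧
    Nat.card {p : F × F × F × F |
        p.2.1 ^ q - p.2.1 = p.1 ^ q₀ * (p.1 ^ q - p.1) ∧
        p.2.2.1 ^ q - p.2.2.1 = p.1 ^ (2 * q₀) * (p.1 ^ q - p.1) ∧
        p.2.2.2 ^ m = p.1 ^ q - p.1} = q ^ 3 := by
  have hqn : q = 3 ^ (2 * s + 1) := by rw [hq, hq₀]; ring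
  have hm0 : m ≠ 0 := by omega
  have hmain : ∀ x y z t : F,
      (y ^ q - y = x ^ q₀ * (x ^ q - x) ∧
       z ^ q - z = x ^ (2 * q₀) * (x ^ q - x) ∧
       t ^ m = x ^ q - x) ↔
      (x ^ q = x ∧ y ^ q = y ∧ z ^ q = z ∧ t = 0) := by
    intro x y z t
    constructor
    · rintro ⟨hy, hz, ht⟩
      have hx : x ^ q = x := by
        rw [hqn, hq₀] at hy hz
        rw [hqn] at hF ⊢
        exact skab_key F s _ hF x y z hy hz
      rw [hx, sub_self] at hy hz ht
      rw [mul_zero, sub_eq_zero] at hy hz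
      exact ⟨hx, hy, hz, pow_eq_zero_iff hm0 |>.mp ht⟩
    · rintro ⟨hx, hy, hz, rfl⟩
      simp [hx, hy, hz, hm0]
  refine ⟨hmain, ?_⟩
  obtain ⟨k, hk⟩ : ∃ k, Fintype.card F = q ^ k := by
    rcases hF with h | h | h
    · exact ⟨1, by rw [h, pow_one]⟩
    · exact ⟨2, h⟩
    · exact ⟨3, h⟩
  have hcard : Nat.card {x : F | x ^ q = x} = q :=
    skab_card_fixed F q k (by rw [hq]; exact dvd_mul_right _ _)
      (by rw [hqn]; exact Nat.one_lt_pow (by omega) (by norm_num)) hk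
  have hset : {p : F × F × F × F |
        p.2.1 ^ q - p.2.1 = p.1 ^ q₀ * (p.1 ^ q - p.1) ∧
        p.2.2.1 ^ q - p.2.2.1 = p.1 ^ (2 * q₀) * (p.1 ^ q - p.1) ∧
        p.2.2.2 ^ m = p.1 ^ q - p.1} =
      {x : F | x ^ q = x} ×ˢ ({x : F | x ^ q = x} ×ˢ
        ({x : F | x ^ q = x} ×ˢ ({0} : Set F))) := by
    ext ⟨x, y, z, t⟩
    simpa using hmain x y z t
  rw [hset]
  simp only [Nat.card_coe_set_eq] at hcard ⊢
  rw [Set.ncard_prod, Set.ncard_prod, Set.ncard_prod, hcard, Set.ncard_singleton]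
  ring
end

section
/- Let s ≥ 1, q₀ = 2^s, q = 2q₀², and let K be any field of characteristic 2. If x, y ∈ K satisfy y^q + y = x^{q₀}(x^q + x), then the element z := y^{2q₀} + x^{2q₀+1} satisfies z^q + z = x^{2q₀}(x^q + x). -/
/-- On the Skabelund curve `S̃_q`, the auxiliary function `z = y^{2q₀} + x^{2q₀+1}`
satisfies `z^q + z = x^{2q₀}(x^q + x)`. -/
theorem skabelund_suzuki_auxiliary_z
    (s : ℕ) (hs : 1 ≤ s) (q₀ q : ℕ)
    (hq₀ : q₀ = 2 ^ s) (hq : q = 2 * q₀ ^ 2)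
    (K : Type*) [Field K] [CharP K 2] (x y : K)
    (h1 : y ^ q + y = x ^ q₀ * (x ^ q + x))
    (z : K) (hz : z = y ^ (2 * q₀) + x ^ (2 * q₀ + 1)) :
    z ^ q + z = x ^ (2 * q₀) * (x ^ q + x) := by
  have e1 : 2 * q₀ = 2 ^ (s + 1) := by rw [hq₀, pow_succ]; ring
  have e2 : q = 2 ^ (2 * s + 1) := by rw [hq, hq₀]; ring
  have f1 : ∀ a b : K, (a + b) ^ (2 * q₀) = a ^ (2 * q₀) + b ^ (2 * q₀) := by
    intro a b
    rw [e1]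
    exact add_pow_char_pow a b 2 (s + 1)
  have f2 : ∀ a b : K, (a + b) ^ q = a ^ q + b ^ q := by
    intro a b
    rw [e2]
    exact add_pow_char_pow a b 2 (2 * s + 1)
  have h2 := congrArg (fun t => t ^ (2 * q₀)) h1
  simp only [mul_pow, f1] at h2
  have e3 : (x ^ q₀) ^ (2 * q₀) = x ^ q := by rw [← pow_mul, hq]; ring_nf
  have e4 : (y ^ (2 * q₀)) ^ q = (y ^ q) ^ (2 * q₀) := pow_right_comm _ _ _
  have e5 : (x ^ (2 * q₀ + 1)) ^ q = (x ^ q) ^ (2 * q₀) * x ^ q := by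
    rw [pow_right_comm, pow_succ]
  have h20 : (2 : K) = 0 := CharTwo.two_eq_zero
  rw [e3] at h2
  rw [hz, f2, e4, e5, pow_succ x]
  linear_combination h2 + (x ^ q) ^ (2 * q₀) * x ^ q * h20
end

section
/- Let s ≥ 1, q₀ = 2^s, q = 2q₀², and let K be any field of characteristic 2. If x, y ∈ K satisfy y^q + y = x^{q₀}(x^q + x), and z := y^{2q₀} + x^{2q₀+1}, then the element w := x·y^{2q₀} + z^{2q₀} satisfies w^q + w = y^{2q₀}(x^q + x). -/
/-- On the Skabelund curve `S̃_q`, the auxiliary function `w = x y^{2q₀} + z^{2q₀}`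
satisfies `w^q + w = y^{2q₀}(x^q + x)`. -/
theorem skabelund_suzuki_auxiliary_w
    (s : ℕ) (hs : 1 ≤ s) (q₀ q : ℕ)
    (hq₀ : q₀ = 2 ^ s) (hq : q = 2 * q₀ ^ 2)
    (K : Type*) [Field K] [CharP K 2] (x y : K)
    (h1 : y ^ q + y = x ^ q₀ * (x ^ q + x))
    (z : K) (hz : z = y ^ (2 * q₀) + x ^ (2 * q₀ + 1))
    (w : K) (hw : w = x * y ^ (2 * q₀) + z ^ (2 * q₀)) :
    w ^ q + w = y ^ (2 * q₀) * (x ^ q + x) := by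
  have e1 : 2 * q₀ = 2 ^ (s + 1) := by rw [hq₀]; ring
  have e2 : q = 2 ^ (2 * s + 1) := by rw [hq, hq₀]; ring
  have : Fact (Nat.Prime 2) := ⟨Nat.prime_two⟩
  have two : (2 : K) = 0 := by exact_mod_cast CharP.cast_eq_zero K 2
  have F : ∀ a b : K, (a + b) ^ (2 * q₀) = a ^ (2 * q₀) + b ^ (2 * q₀) := by
    intro a b; rw [e1]; exact add_pow_char_pow a b 2 _
  have G : ∀ a b : K, (a + b) ^ q = a ^ q + b ^ q := by
    intro a b; rw [e2]; exact add_pow_char_pow a b 2 _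
  have FF : ∀ a : K, (a ^ (2 * q₀)) ^ (2 * q₀) = (a ^ q) ^ 2 := by
    intro a; rw [← pow_mul, ← pow_mul]; congr 1; rw [hq]; ring
  have C : ∀ a : K, (a ^ (2 * q₀)) ^ q = (a ^ q) ^ (2 * q₀) := by
    intro a; rw [← pow_mul, ← pow_mul, mul_comm]
  have D : (x ^ q₀) ^ (2 * q₀) = x ^ q := by
    rw [← pow_mul]; congr 1; rw [hq]; ring
  have E : (x ^ q₀) ^ 2 = x ^ (2 * q₀) := by rw [← pow_mul, mul_comm]
  have C2 : ∀ a : K, (a ^ 2) ^ q = (a ^ q) ^ 2 := by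
    intro a; rw [← pow_mul, ← pow_mul, mul_comm]
  have h2 := congrArg (fun a => a ^ (2 * q₀)) h1
  simp only [F, mul_pow, D] at h2
  have h3 : (y ^ q) ^ 2 + y ^ 2 = x ^ (2 * q₀) * ((x ^ q) ^ 2 + x ^ 2) := by
    rw [← E]
    linear_combination (y ^ q + y + x ^ q₀ * (x ^ q + x)) * h1
      + ((x ^ q₀) ^ 2 * x ^ q * x - y ^ q * y) * two
  have hw2 : w = x * y ^ (2 * q₀) + y ^ 2 + x ^ (2 * q₀) * x ^ 2 := by
    rw [hw, hz, F, FF, pow_succ x (2 * q₀), mul_pow, FF]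
    linear_combination h3 + ((x ^ q) ^ 2 * x ^ (2 * q₀) - y ^ 2) * two
  have hwq : w ^ q = x ^ q * (y ^ q) ^ (2 * q₀) + (y ^ q) ^ 2
      + (x ^ q) ^ (2 * q₀) * (x ^ q) ^ 2 := by
    rw [hw2, G, G, mul_pow, mul_pow, C, C, C2, C2]
  rw [hwq, hw2]
  generalize x ^ q = X at *
  generalize y ^ q = Y at *
  generalize X ^ (2 * q₀) = A at *
  generalize Y ^ (2 * q₀) = B at *
  generalize x ^ (2 * q₀) = a at *
  generalize y ^ (2 * q₀) = b at *
  linear_combination X * h2 + h3 + (A * X ^ 2 + a * X ^ 2 + a * x ^ 2 - X * b) * two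
end

section
/- Let s ≥ 1, q₀ = 3^s, q = 3q₀², m = q − 3q₀ + 1, let K be a field of characteristic 3, and let b, c, d ∈ K satisfy b^q = b, c^q = c, and d^q = d. If (x, y, z, t) ∈ K⁴ satisfies y^q − y = x^{q₀}(x^q − x), z^q − z = x^{2q₀}(x^q − x), and t^m = x^q − x, then (x + b, y + b^{q₀}x + c, z − b^{q₀}y + b^{2q₀}x + d, t) also satisfies these three equations (with the new coordinates in place of (x, y, z, t)). -/
/-- The translation maps `(x, y, z, t) ↦ (x + b, y + b^{q₀} x + c, z - b^{q₀} y + b^{2q₀} x + d, t)`,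
with `b, c, d ∈ F_q`, preserve the defining equations of the Skabelund curve `R̃_q`. -/
theorem skabelund_ree_translation_automorphism
    (s : ℕ) (hs : 1 ≤ s) (q₀ q m : ℕ)
    (hq₀ : q₀ = 3 ^ s) (hq : q = 3 * q₀ ^ 2) (hm : m = q - 3 * q₀ + 1)
    (K : Type*) [Field K] [CharP K 3] (b c d : K)
    (hb : b ^ q = b) (hc : c ^ q = c) (hd : d ^ q = d)
    (x y z t : K)
    (h1 : y ^ q - y = x ^ q₀ * (x ^ q - x))
    (h2 : z ^ q - z = x ^ (2 * q₀) * (x ^ q - x))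
    (h3 : t ^ m = x ^ q - x) :
    (y + b ^ q₀ * x + c) ^ q - (y + b ^ q₀ * x + c)
        = (x + b) ^ q₀ * ((x + b) ^ q - (x + b)) ∧
    (z - b ^ q₀ * y + b ^ (2 * q₀) * x + d) ^ q - (z - b ^ q₀ * y + b ^ (2 * q₀) * x + d)
        = (x + b) ^ (2 * q₀) * ((x + b) ^ q - (x + b)) ∧
    t ^ m = (x + b) ^ q - (x + b) := by
  have hqp : q = 3 ^ (2 * s + 1) := by rw [hq, hq₀]; ring
  have : Fact (Nat.Prime 3) := ⟨Nat.prime_three⟩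
  have h30 : (3 : K) = 0 := by exact_mod_cast CharP.cast_eq_zero K 3
  have addq : ∀ u v : K, (u + v) ^ q = u ^ q + v ^ q := by
    intro u v; rw [hqp]; exact add_pow_char_pow u v _ _
  have subq : ∀ u v : K, (u - v) ^ q = u ^ q - v ^ q := by
    intro u v; rw [hqp]; exact sub_pow_char_pow u v _
  have addq0 : (x + b) ^ q₀ = x ^ q₀ + b ^ q₀ := by
    rw [hq₀]; exact add_pow_char_pow x b _ _
  have hB : (b ^ q₀) ^ q = b ^ q₀ := by rw [pow_right_comm, hb]
  have two : ∀ u : K, u ^ (2 * q₀) = (u ^ q₀) ^ 2 := by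
    intro u; rw [mul_comm, pow_mul]
  have hB2 : ((b ^ q₀) ^ 2) ^ q = (b ^ q₀) ^ 2 := by rw [pow_right_comm, hB]
  rw [two] at h2
  simp only [two, addq, subq, mul_pow, addq0, hB, hB2, hb, hc, hd]
  refine ⟨?_, ?_, ?_⟩
  · linear_combination h1
  · linear_combination h2 - b ^ q₀ * h1 - x ^ q₀ * b ^ q₀ * (x ^ q - x) * h30
  · linear_combination h3
end
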